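/- From the position P0, placing a chap at b3 is Alfred's unique non-losing move: after Alfred places a chap at b3, Betty has no winning strategy from the resulting position, while after every other legal move of Alfred from P0, Betty has a winning strategy from the resulting position. -/

import Mathlib

/-!
Formalization of Philosophers' Phutball on an `m × n` board (`m` rows, `n` columns).
Points are pairs `(column, row)` of integers, with columns `1, …, n` (a, b, c, …)
and rows `1, …, m` (bottom to top).  Player `true` is Alfred (first player, aims
for the top row `m`); player `false` is Betty (aims for the bottom row `1`).
-/

/-- A player: `true` is Alfred, `false` is Betty. -/
abbrev Player := Bool

/-- A Phutball position: the ball's point `(column, row)`, the finite set of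
chaps, and the player whose turn it is. -/
structure PState where
  ball : ℤ × ℤ
  chaps : Finset (ℤ × ℤ)
  turn : Player
deriving DecidableEq

/-- The eight horizontal, vertical and diagonal directions. -/
def dirs : Finset (ℤ × ℤ) :=
  {(1, 0), (1, 1), (0, 1), (-1, 1), (-1, 0), (-1, -1), (0, -1), (1, -1)}

/-- The point reached from `b` after `i` steps in direction `d`. -/
def ray (b d : ℤ × ℤ) (i : ℤ) : ℤ × ℤ := (b.1 + i * d.1, b.2 + i * d.2)

/-- A point is on the `m × n` board. -/
def OnBoard (m n : ℤ) (p : ℤ × ℤ) : Prop :=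
  1 ≤ p.1 ∧ p.1 ≤ n ∧ 1 ≤ p.2 ∧ p.2 ≤ m

/-- A single hop on a board with `n` columns: the ball at `b` moves in one of the
eight directions `d` over a contiguous nonempty line of `k` chaps, landing on the
first point beyond them that carries no chap; the jumped-over chaps are removed.
The landing point must not lie onto or past the sidelines (outside columns
`1, …, n`), but it may lie past the top or bottom row. -/
def Hop (n : ℤ) (b : ℤ × ℤ) (c : Finset (ℤ × ℤ)) (b' : ℤ × ℤ) (c' : Finset (ℤ × ℤ)) : Prop :=
  ∃ d ∈ dirs, ∃ k : ℕ, 1 ≤ k ∧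
    (∀ i : ℕ, 1 ≤ i → i ≤ k → ray b d i ∈ c) ∧
    ray b d (k + 1) ∉ c ∧
    1 ≤ (ray b d (k + 1)).1 ∧ (ray b d (k + 1)).1 ≤ n ∧
    b' = ray b d (k + 1) ∧
    c' = c \ Finset.image (fun i : ℕ => ray b d i) (Finset.Icc 1 k)

/-- A jump is a nonempty sequence of hops (the player may stop after any hop,
and the removed chaps cannot be re-used by later hops of the same jump).  The
jump can continue after a hop only if the ball has not been carried past the top
or bottom row (which would end the game immediately). -/
inductive Jump (m n : ℤ) : ℤ × ℤ → Finset (ℤ × ℤ) → ℤ × ℤ → Finset (ℤ × ℤ) → Prop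
  | single {b c b' c'} : Hop n b c b' c' → Jump m n b c b' c'
  | cons {b c b₁ c₁ b' c'} : Hop n b c b₁ c₁ → 1 ≤ b₁.2 → b₁.2 ≤ m →
      Jump m n b₁ c₁ b' c' → Jump m n b c b' c'

/-- The winner, if any, of a position (evaluated between turns): Alfred wins if
the ball rests on the top row `m` or has been carried past it; Betty wins if the
ball rests on the bottom row `1` or has been carried past it. -/
def winner (m : ℤ) (s : PState) : Option Player :=
  if m ≤ s.ball.2 then some true else if s.ball.2 ≤ 1 then some false else none

/-- A single legal move on the `m × n` board: the player to move either places a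
chap on a vacant on-board point, or moves the ball by a jump; the turn passes to
the other player. -/
def MoveRel (m n : ℤ) (s t : PState) : Prop :=
  t.turn = !s.turn ∧
    ((∃ p, OnBoard m n p ∧ p ∉ s.chaps ∧ p ≠ s.ball ∧
        t.ball = s.ball ∧ t.chaps = insert p s.chaps) ∨
      Jump m n s.ball s.chaps t.ball t.chaps)

/-- An infinite record of play: while the game is not over and a legal move
exists, a legal move is made; otherwise the position is frozen forever. -/
def IsPlay (m n : ℤ) (f : ℕ → PState) : Prop :=
  ∀ k,
    (winner m (f k) = none ∧ (∃ t, MoveRel m n (f k) t) ∧ MoveRel m n (f k) (f (k + 1))) ∨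
    ((winner m (f k) ≠ none ∨ ¬ ∃ t, MoveRel m n (f k) t) ∧ f (k + 1) = f k)

/-- A strategy for player `p` that always proposes a legal move whenever the game
is not over, it is `p`'s turn, and some legal move exists. -/
def LegalStrategy (m n : ℤ) (p : Player) (σ : PState → PState) : Prop :=
  ∀ s, s.turn = p → winner m s = none → (∃ t, MoveRel m n s t) → MoveRel m n s (σ s)

/-- The play `f` follows the strategy `σ` of player `p`. -/
def Follows (m n : ℤ) (p : Player) (σ : PState → PState) (f : ℕ → PState) : Prop :=
  ∀ k, (f k).turn = p → winner m (f k) = none → (∃ t, MoveRel m n (f k) t) →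
    f (k + 1) = σ (f k)

/-- Player `p` has a winning strategy from `s₀` on the `m × n` board: a legal
strategy guaranteeing that, against every play of the opponent, `p` wins after
finitely many moves. -/
def WinsFrom (m n : ℤ) (p : Player) (s₀ : PState) : Prop :=
  ∃ σ, LegalStrategy m n p σ ∧
    ∀ f, IsPlay m n f → f 0 = s₀ → Follows m n p σ f → ∃ k, winner m (f k) = some p

/-- Player `p` has a drawing strategy from `s₀` on the `m × n` board: a legal
strategy guaranteeing that the opponent never wins (play may continue forever). -/
def DrawsFrom (m n : ℤ) (p : Player) (s₀ : PState) : Prop :=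
  ∃ σ, LegalStrategy m n p σ ∧
    ∀ f, IsPlay m n f → f 0 = s₀ → Follows m n p σ f → ∀ k, winner m (f k) ≠ some (!p)

/-- A position is drawn if both players have drawing strategies from it. -/
def Drawn (m n : ℤ) (s : PState) : Prop :=
  DrawsFrom m n true s ∧ DrawsFrom m n false s

/-- The 24 chaps of the position `P0` on the 12 × 10 board:
c1, c2, c5, c7, c9, c10, c11, c12, d6, e4, e11, e12, f1, f2, f9, g7,
h1, h2, h3, h4, h6, h8, h11, h12. -/
def P0chaps : Finset (ℤ × ℤ) :=
  {(3, 1), (3, 2), (3, 5), (3, 7), (3, 9), (3, 10), (3, 11), (3, 12), (4, 6), (5, 4), (5, 11), (5, 12), (6, 1), (6, 2), (6, 9), (7, 7), (8, 1), (8, 2), (8, 3), (8, 4), (8, 6), (8, 8), (8, 11), (8, 12)}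

/-- The position `P0`: ball at a2 = (1, 2), the 24 chaps above, Alfred to move. -/
def P0 : PState := ⟨(1, 2), P0chaps, true⟩

/-- The result of Alfred placing a chap at b3 = (2, 3) from `P0`. -/
def P0_b3 : PState := ⟨(1, 2), insert (2, 3) P0.chaps, false⟩

namespace Phutball

section Games

variable {m n : ℤ} {p : Player} {T : PState → Prop}

/-- Player `p` can, within `k` moves, win or enter `T`. -/
def Reach (m n : ℤ) (p : Player) (T : PState → Prop) : ℕ → PState → Prop
  | 0, s => winner m s = some p ∨ T s
  | k + 1, s => Reach m n p T k s ∨ winner m s = none ∧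
      (s.turn = p ∧ (∃ t, MoveRel m n s t ∧ Reach m n p T k t) ∨
        s.turn = !p ∧ (∃ t, MoveRel m n s t) ∧ ∀ t, MoveRel m n s t → Reach m n p T k t)

theorem Reach.mono {j k : ℕ} (hjk : j ≤ k) {s : PState} (h : Reach m n p T j s) :
    Reach m n p T k s := by
  induction hjk with
  | refl => exact h
  | step _ ih => exact Or.inl ih

theorem Reach.winner_or {k : ℕ} {s : PState} (h : Reach m n p T k s) :
    winner m s = some p ∨ winner m s = none ∨ T s := by
  induction k with
  | zero => exact h.imp_right Or.inr
  | succ k ih => exact h.elim ih fun h => Or.inr (Or.inl h.1)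

theorem Reach.exists_move {k : ℕ} {s : PState} (h : Reach m n p T k s)
    (hw : winner m s = none) (ht : s.turn = p) (hT : ¬ T s) :
    ∃ j < k, ∃ t, MoveRel m n s t ∧ Reach m n p T j t := by
  induction k with
  | zero => rcases h with h | h
            · simp [hw] at h
            · exact absurd h hT
  | succ k ih =>
    rcases h with h | ⟨-, ⟨-, h⟩ | ⟨h, -⟩⟩
    · obtain ⟨j, hj, h⟩ := ih h
      exact ⟨j, by omega, h⟩
    · exact ⟨k, by omega, h⟩
    · simp [ht] at h

theorem Reach.forall_move {k : ℕ} {s : PState} (h : Reach m n p T k s)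
    (hw : winner m s = none) (ht : s.turn = !p) (hT : ¬ T s) :
    ∃ j < k, (∃ t, MoveRel m n s t) ∧ ∀ t, MoveRel m n s t → Reach m n p T j t := by
  induction k with
  | zero => rcases h with h | h
            · simp [hw] at h
            · exact absurd h hT
  | succ k ih =>
    rcases h with h | ⟨-, ⟨h, -⟩ | ⟨-, h⟩⟩
    · obtain ⟨j, hj, h⟩ := ih h
      exact ⟨j, by omega, h⟩
    · simp [ht] at h
    · exact ⟨k, by omega, h⟩

theorem winsFrom_of_reach {k : ℕ} {s₀ : PState} (h : Reach m n p (fun _ => False) k s₀) :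
    WinsFrom m n p s₀ := by
  have key : ∀ s, ∃ t, ((∃ t, MoveRel m n s t) → MoveRel m n s t) ∧
      ∀ j, (∃ t, MoveRel m n s t ∧ Reach m n p (fun _ => False) j t) →
        Reach m n p (fun _ => False) j t := by
    intro s
    by_cases hs : ∃ j t, MoveRel m n s t ∧ Reach m n p (fun _ => False) j t
    · classical
      obtain ⟨t, hm, ht⟩ := Nat.find_spec hs
      exact ⟨t, fun _ => hm, fun j hj => ht.mono (Nat.find_min' hs hj)⟩
    · push Not at hs
      by_cases hm : ∃ t, MoveRel m n s t
      · obtain ⟨t, ht⟩ := hm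
        exact ⟨t, fun _ => ht, fun j ⟨u, hu, hr⟩ => absurd hr (hs j u hu)⟩
      · exact ⟨s, fun h => absurd h hm, fun j ⟨u, hu, _⟩ => absurd ⟨u, hu⟩ hm⟩
  choose σ hσ hσr using key
  refine ⟨σ, fun s _ _ hm => hσ s hm, fun f hf h0 hfol => ?_⟩
  have main : ∀ k i, Reach m n p (fun _ => False) k (f i) → ∃ j, winner m (f j) = some p := by
    intro k
    induction k using Nat.strong_induction_on with
    | _ k ih =>
      intro i hi
      rcases hi.winner_or with hw | hw | hF
      · exact ⟨i, hw⟩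
      · by_cases ht : (f i).turn = p
        · obtain ⟨j, hj, t, hm, hr⟩ := hi.exists_move hw ht id
          refine ih j hj (i + 1) ?_
          rw [hfol i ht hw ⟨t, hm⟩]
          exact hσr _ j ⟨t, hm, hr⟩
        · obtain ⟨j, hj, hex, hall⟩ := hi.forall_move hw (Bool.eq_not_of_ne ht) id
          rcases hf i with ⟨-, -, hm⟩ | ⟨hn, -⟩
          · exact ih j hj (i + 1) (hall _ hm)
          · exact absurd hn (by simp [hw, hex])
      · exact hF.elim
  exact main k 0 (h0 ▸ h)

/-- If the opponent of `p` cannot leave the `p`-attractor of `T`, the opponent does not win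
from `T`. -/
theorem not_winsFrom_of_trap
    (hT : ∀ s, T s → winner m s = none ∧ s.turn = (!p) ∧
      ∃ k, ∀ t, MoveRel m n s t → Reach m n p T k t)
    {s₀ : PState} (h₀ : T s₀) : ¬ WinsFrom m n (!p) s₀ := by
  rintro ⟨σ, hσ, hwin⟩
  let G : PState → Prop := fun s => ∃ k, Reach m n p T k s
  have hopp : ∀ s, G s → winner m s = none → s.turn = (!p) → ∀ t, MoveRel m n s t → G t := by
    rintro s ⟨k, hk⟩ hw ht t hm
    by_cases hs : T s
    · obtain ⟨k, hk⟩ := (hT s hs).2.2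
      exact ⟨k, hk t hm⟩
    · obtain ⟨j, -, -, h⟩ := hk.forall_move hw ht hs
      exact ⟨j, h t hm⟩
  have hnext : ∀ s, ∃ t, G s →
      ((winner m s = none ∧ (∃ t, MoveRel m n s t) ∧ MoveRel m n s t) ∨
        ((winner m s ≠ none ∨ ¬ ∃ t, MoveRel m n s t) ∧ t = s)) ∧
      (s.turn = (!p) → winner m s = none → (∃ t, MoveRel m n s t) → t = σ s) ∧ G t := by
    intro s
    by_cases hG : G s
    swap
    · exact ⟨s, fun h => absurd h hG⟩
    by_cases hc : winner m s = none ∧ ∃ t, MoveRel m n s t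
    swap
    · refine ⟨s, fun _ => ⟨Or.inr ⟨?_, rfl⟩, fun _ h1 h2 => absurd ⟨h1, h2⟩ hc, hG⟩⟩
      by_contra! h
      exact hc h
    obtain ⟨hw, hex⟩ := hc
    by_cases ht : s.turn = !p
    · have hm := hσ s ht hw hex
      exact ⟨σ s, fun _ => ⟨Or.inl ⟨hw, hex, hm⟩, fun _ _ _ => rfl, hopp s hG hw ht _ hm⟩⟩
    · obtain ⟨k, hk⟩ := hG
      have hp : s.turn = p := by simpa using Bool.eq_not_of_ne ht
      obtain ⟨j, -, t, hm, hr⟩ := hk.exists_move hw hp fun hs => ht (hT s hs).2.1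
      exact ⟨t, fun _ => ⟨Or.inl ⟨hw, hex, hm⟩, fun h => absurd h ht, j, hr⟩⟩
  choose g hg using hnext
  let f : ℕ → PState := fun k => g^[k] s₀
  have hf : ∀ k, f (k + 1) = g (f k) := fun k => Function.iterate_succ_apply' g k s₀
  have hG : ∀ k, G (f k) := by
    intro k
    induction k with
    | zero => exact ⟨0, Or.inr h₀⟩
    | succ k ih => rw [hf]; exact (hg _ ih).2.2
  obtain ⟨k, hk⟩ := hwin f (fun k => by rw [hf]; exact (hg _ (hG k)).1) rfl
    (fun k => by rw [hf]; exact (hg _ (hG k)).2.1)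
  obtain ⟨j, hj⟩ := hG k
  rcases hj.winner_or with h | h | h
  · simp [hk] at h
  · simp [hk] at h
  · have := (hT _ h).1
    simp [hk] at this

end Games

section Computation

/-! A point `(x, y)` is coded by `x + 16 * y`, a set of points by the number with these bits set,
and a direction `(x, y)` by `x + 1 + 16 * (y + 1)`. -/

/-- Whether the set `c` contains `p`. -/
def occupied (c p : ℕ) : Bool := Nat.beq (Nat.land (Nat.shiftRight c p) 1) 1

/-- Whether `p` is not beyond the sidelines. -/
def legalColumn (p : ℕ) : Bool := Nat.ble 1 (Nat.mod p 16) && Nat.ble (Nat.mod p 16) 10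

/-- Whether `p` is not beyond the goallines. -/
def onRows (p : ℕ) : Bool := Nat.ble 16 p && Nat.ble p 207

/-- Whether a ball resting at `p` is a win of `pl`. -/
def wonBy (pl : Bool) (p : ℕ) : Bool := cond pl (Nat.ble 192 p) (Nat.ble p 31)

/-- Whether a ball resting at `p` is a win of neither player. -/
def undecided (p : ℕ) : Bool := Nat.ble 32 p && Nat.ble p 191

/-- The point next to `p` in direction `D`. -/
def step (p D : ℕ) : ℕ := Nat.sub (Nat.add p D) 17

/-- The set `c` with `q` added. -/
def place (c q : ℕ) : ℕ := Nat.lor c (Nat.pow 2 q)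

/-- Move from `p` in direction `D` past the chaps, removing them, and apply `k` to the point reached
and the remaining chaps. The value is `out` if more than the given number of steps is needed. -/
def slide {α : Type} (k : ℕ → ℕ → α) (out : α) (D : ℕ) : ℕ → ℕ → ℕ → α
  | 0, _, _ => out
  | f + 1, p, c =>
    cond (occupied c p) (slide k out D f (step p D) (Nat.xor c (Nat.pow 2 p))) (k p c)

/-- Apply `k` to the result of the hop from `b` in direction `D`; the value is `illegal` if there is
no such hop. -/
def hop {α : Type} (k : ℕ → ℕ → α) (out illegal : α) (b c D : ℕ) : α :=
  cond (occupied c (step b D))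
    (slide (fun p c' => cond (legalColumn p) (k p c') illegal) out D 13 (step b D) c) illegal

/-- The codes of the eight directions. -/
def codes : List ℕ := [18, 34, 33, 32, 16, 0, 1, 2]

/-- Whether some jump of at most the given number of hops satisfies `f`. -/
def jumpAny (f : ℕ → ℕ → Bool) : ℕ → ℕ → ℕ → Bool
  | 0, _, _ => false
  | n + 1, b, c => codes.any (hop (fun p c' => f p c' || (onRows p && jumpAny f n p c'))
      false false b c)

/-- Whether all jumps satisfy `f` and have at most the given number of hops. -/
def jumpAll (f : ℕ → ℕ → Bool) : ℕ → ℕ → ℕ → Bool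
  | 0, _, _ => false
  | n + 1, b, c => codes.all (hop (fun p c' => f p c' && (!onRows p || jumpAll f n p c'))
      false true b c)

/-- The landing points of a winning jump of `pl`. -/
def threat (pl : Bool) : ℕ → ℕ → ℕ → Option (List ℕ)
  | 0, _, _ => none
  | n + 1, b, c => codes.findSome? (hop (fun p c' => cond (wonBy pl p) (some [p])
      (cond (onRows p) ((threat pl n p c').map (List.cons p)) none)) none none b c)

/-- Whether a chap may be placed at `q`. -/
def vacant (b c q : ℕ) : Bool :=
  legalColumn q && (onRows q && (!Nat.beq q b && !occupied c q))

/-- The points of the `12 × 10` board. -/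
def allPoints : List ℕ := (List.range 208).filter fun q => legalColumn q && onRows q

/-- The opponent of `pl` is to move: every jump loses or meets `attack`, and so does the placement
of a chap at any of `points`. -/
def defend (pl : Bool) (attack : ℕ → ℕ → Bool) (points : List ℕ) (b c : ℕ) : Bool :=
  jumpAll (fun p c' => wonBy pl p || (undecided p && attack p c')) 20 b c &&
    points.all fun q => !vacant b c q || attack b (place c q)

/-- The first free point in direction `D`, provided that the ball cannot hop there unless this
carries it off the board to a win of `pl`. -/
def escape (pl : Bool) (b c D : ℕ) : Option ℕ :=
  slide (fun p _ => cond (Nat.beq p (step b D) || !legalColumn p || (wonBy pl p && !onRows p))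
    (some p) none) none D 13 (step b D) c

/-- The points found by `escape`, for all directions `D` in a list. -/
def escapes (pl : Bool) (b c : ℕ) : List ℕ → Option (List ℕ)
  | [] => some []
  | D :: l => (escape pl b c D).bind fun p => (escapes pl b c l).map (List.cons p)

/-- If placing a chap at `r` makes a winning jump of `pl` that the opponent can neither block nor
escape, the points at which a chap placed beforehand may interfere. -/
def follow (pl : Bool) (b c r : ℕ) : Option (List ℕ) :=
  cond (vacant b c r)
    ((threat pl 20 b (place c r)).bind fun path =>
      cond (path.any (vacant b (place c r))) none
        ((escapes pl b (place c r) codes).map fun exits => exits ++ (path ++ [r])))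
    none

/-- The points at which the opponent has to place a chap, if not jumping: on the path of a winning
jump of `pl`, or else against the follow-up `r`. -/
def pressure (pl : Bool) (b c : ℕ) (r : Option ℕ) : Option (List ℕ) :=
  (threat pl 20 b c).or (r.bind (follow pl b c))

/-- Whether position `b`, `c` belongs to the list `T`. -/
def listed (T : List (ℕ × ℕ)) (b c : ℕ) : Bool := T.any fun e => Nat.beq e.1 b && Nat.beq e.2 c

/-- Search for a forced win of `pl`, who is to move, or entry into `T`. Each entry of the plan
lists the placements to be tried at one move, with optional follow-ups. -/
def solve (T : List (ℕ × ℕ)) (pl : Bool) : List (List (ℕ × Option ℕ)) → ℕ → ℕ → Bool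
  | [], b, c => jumpAny (fun p _ => wonBy pl p) 20 b c
  | hints :: plan, b, c =>
    jumpAny (fun p c' => wonBy pl p || (undecided p && listed T p c')) 20 b c ||
    hints.any fun h => vacant b c h.1 && (listed T b (place c h.1) ||
      match pressure pl b (place c h.1) h.2 with
      | some points => defend pl (solve T pl plan) points b (place c h.1)
      | none => false)

/-- The chaps of `P0`. -/
def chapCodes : List ℕ :=
  [19, 35, 83, 115, 147, 163, 179, 195, 100, 69, 181, 197, 22, 38, 150, 119, 24, 40, 56, 72, 104,
    136, 184, 200]

/-- The set of points in a list. -/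
def mask (l : List ℕ) : ℕ := l.foldr (fun q c => place c q) 0

/-- The points b3, c4, d5, e6, f7, g8, h9, i10. -/
def ladder : List ℕ := [50, 67, 84, 101, 118, 135, 152, 169]

/-- Positions with Betty to move, and the ball at a2 or j11, that Betty cannot leave to her
advantage. -/
def trap : List (ℕ × ℕ) :=
  [(33, mask (ladder.take 1 ++ chapCodes)), (33, mask (ladder.take 3 ++ chapCodes)),
   (33, mask (ladder.take 5 ++ chapCodes)), (33, mask (ladder.take 7 ++ chapCodes)),
   (186, mask chapCodes), (186, mask (ladder.drop 6 ++ chapCodes)),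
   (186, mask (ladder.drop 4 ++ chapCodes)), (186, mask (ladder.drop 2 ++ chapCodes)),
   (186, mask (ladder ++ chapCodes))]

/-- Betty's plan against every move from `P0` other than b3. -/
def bettyPlan : List (List (ℕ × Option ℕ)) := [[(17, none), (49, none)], [(49, none)]]

/-- Alfred's plan in the trap, except for its last position. -/
def shortPlan : List (List (ℕ × Option ℕ)) :=
  [[(100, none), (84, none), (83, none), (118, none), (152, none), (120, none), (153, none),
    (50, none), (202, none)], [(153, none), (170, none)], []]

/-- Alfred's plan in the last position of the trap. -/
def longPlan : List (List (ℕ × Option ℕ)) :=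
  [[(33, some 202), (201, none), (50, none)], [(50, none)], [(84, none), (100, none)],
    [(118, none), (83, none)], [(152, none), (153, none), (120, none)], [(136, none)]]

end Computation

section Representation

/-- The point of the board coded by a number. -/
def point (i : ℕ) : ℤ × ℤ := ((i % 16 : ℕ), (i / 16 : ℕ))

/-- The direction coded by a number. -/
def vec (D : ℕ) : ℤ × ℤ := ((D % 16 : ℕ) - 1, (D / 16 : ℕ) - 1)

/-- The bits of `c` are the codes of the points in `C`, all of which are on the board. -/
structure Rep (c : ℕ) (C : Finset (ℤ × ℤ)) : Prop where
  onBoard : ∀ q ∈ C, OnBoard 12 10 q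
  testBit_iff : ∀ i, c.testBit i = true ↔ point i ∈ C

theorem point_injective : Function.Injective point := by
  intro i j h
  simp only [point, Prod.mk.injEq, Nat.cast_inj] at h
  omega

theorem exists_point_eq {q : ℤ × ℤ} (hq : OnBoard 12 10 q) : ∃ i, point i = q := by
  obtain ⟨x, y⟩ := q
  simp only [OnBoard] at hq
  refine ⟨x.toNat + 16 * y.toNat, ?_⟩
  simp only [point, Prod.mk.injEq]
  omega

theorem occupied_eq (c i : ℕ) : occupied c i = c.testBit i := by
  have h : Nat.land (Nat.shiftRight c i) 1 = (c >>> i) % 2 := Nat.and_one_is_mod _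
  rw [occupied, h, Nat.testBit_eq_decide_div_mod_eq, Nat.shiftRight_eq_div_pow,
    Bool.eq_iff_iff, Nat.beq_eq, decide_eq_true_iff]

theorem legalColumn_iff {i : ℕ} :
    legalColumn i = true ↔ 1 ≤ (point i).1 ∧ (point i).1 ≤ 10 := by
  have h : Nat.mod i 16 = i % 16 := rfl
  simp only [legalColumn, point, Bool.and_eq_true, Nat.ble_eq, h]
  omega

theorem onRows_iff {i : ℕ} : onRows i = true ↔ 1 ≤ (point i).2 ∧ (point i).2 ≤ 12 := by
  simp only [onRows, point, Bool.and_eq_true, Nat.ble_eq]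
  omega

theorem onBoard_point_iff {i : ℕ} :
    OnBoard 12 10 (point i) ↔ legalColumn i = true ∧ onRows i = true := by
  rw [legalColumn_iff, onRows_iff, OnBoard]
  tauto

theorem winner_point (i : ℕ) (C : Finset (ℤ × ℤ)) (t : Player) :
    winner 12 ⟨point i, C, t⟩ =
      if 192 ≤ i then some true else if i ≤ 31 then some false else none := by
  have h₁ : 12 ≤ (point i).2 ↔ 192 ≤ i := by
    simp only [point]
    omega
  have h₂ : (point i).2 ≤ 1 ↔ i ≤ 31 := by
    simp only [point]
    omega
  simp only [winner, h₁, h₂]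

theorem wonBy_iff {pl : Bool} {i : ℕ} {C : Finset (ℤ × ℤ)} {t : Player} :
    wonBy pl i = true ↔ winner 12 ⟨point i, C, t⟩ = some pl := by
  rw [winner_point]
  cases pl <;> split_ifs <;> simp [wonBy] <;> omega

theorem undecided_iff {i : ℕ} {C : Finset (ℤ × ℤ)} {t : Player} :
    undecided i = true ↔ winner 12 ⟨point i, C, t⟩ = none := by
  rw [winner_point]
  split_ifs <;> simp [undecided] <;> omega

theorem onBoard_of_undecided {i : ℕ} (h₁ : legalColumn i = true) (h₂ : undecided i = true) :
    OnBoard 12 10 (point i) := by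
  rw [legalColumn_iff] at h₁
  simp only [undecided, point, Bool.and_eq_true, Nat.ble_eq, OnBoard] at *
  omega

theorem Rep.occupied_iff {c : ℕ} {C : Finset (ℤ × ℤ)} (h : Rep c C) (i : ℕ) :
    occupied c i = true ↔ point i ∈ C := by
  rw [occupied_eq, h.testBit_iff]

theorem Rep.place {c : ℕ} {C : Finset (ℤ × ℤ)} (h : Rep c C) {q : ℕ}
    (hq : OnBoard 12 10 (point q)) : Rep (place c q) (insert (point q) C) where
  onBoard := by
    simpa using ⟨hq, fun a b hab => h.onBoard (a, b) hab⟩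
  testBit_iff i := by
    have e : Phutball.place c q = c ||| 2 ^ q := rfl
    rw [e, Nat.testBit_or, Nat.testBit_two_pow, Finset.mem_insert, point_injective.eq_iff,
      ← h.testBit_iff]
    simp only [Bool.or_eq_true, decide_eq_true_iff]
    rw [or_comm, eq_comm]

theorem Rep.erase {c : ℕ} {C : Finset (ℤ × ℤ)} (h : Rep c C) {q : ℕ} (hq : point q ∈ C) :
    Rep (Nat.xor c (Nat.pow 2 q)) (C.erase (point q)) where
  onBoard p hp := h.onBoard p (Finset.mem_of_mem_erase hp)
  testBit_iff i := by
    have e : Nat.xor c (Nat.pow 2 q) = c ^^^ 2 ^ q := rfl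
    rw [e, Nat.testBit_xor, Nat.testBit_two_pow, Finset.mem_erase, ← h.testBit_iff,
      point_injective.ne_iff]
    rw [← h.testBit_iff] at hq
    by_cases hi : q = i
    · simp [← hi, hq]
    · simp [hi, Ne.symm hi]

theorem Rep.mask {l : List ℕ} (h : ∀ q ∈ l, OnBoard 12 10 (point q)) :
    Rep (mask l) (l.map point).toFinset := by
  induction l with
  | nil => exact ⟨by simp, fun i => by
      rw [show Phutball.mask [] = 0 from rfl]
      simp⟩
  | cons q l ih =>
    rw [List.map_cons, List.toFinset_cons]
    exact (ih fun p hp => h p (List.mem_cons_of_mem q hp)).place (h q List.mem_cons_self)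

theorem mem_dirs_iff {v : ℤ × ℤ} : v ∈ dirs ↔ ∃ D ∈ codes, vec D = v := by
  simp [dirs, codes, vec, eq_comm]

theorem point_step {i D : ℕ} (hi : OnBoard 12 10 (point i)) (hD : D ∈ codes) :
    point (step i D) = ((point i).1 + (vec D).1, (point i).2 + (vec D).2) := by
  have e : step i D = i + D - 17 := rfl
  rw [e]
  simp only [codes, List.mem_cons, List.not_mem_nil, or_false] at hD
  simp only [point, OnBoard, vec, Prod.mk.injEq] at *
  rcases hD with rfl | rfl | rfl | rfl | rfl | rfl | rfl | rfl <;> omega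

theorem ray_injective {b v : ℤ × ℤ} (hv : v ∈ dirs) : Function.Injective (ray b v) := by
  intro i j h
  simp only [ray, Prod.mk.injEq, add_right_inj] at h
  simp only [dirs, Finset.mem_insert, Finset.mem_singleton] at hv
  rcases hv with rfl | rfl | rfl | rfl | rfl | rfl | rfl | rfl <;> simp_all

end Representation

section Hops

/-- The first `k` points met by the ball at `b` in direction `v`. -/
abbrev jumped (b v : ℤ × ℤ) (k : ℕ) : Finset (ℤ × ℤ) :=
  Finset.image (fun i : ℕ => ray b v i) (Finset.Icc 1 k)

theorem ray_mem_jumped {b v : ℤ × ℤ} (hv : v ∈ dirs) {i k : ℕ} :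
    ray b v i ∈ jumped b v k ↔ 1 ≤ i ∧ i ≤ k := by
  have : Function.Injective fun i : ℕ => ray b v i :=
    (ray_injective hv).comp Nat.cast_injective
  rw [jumped, this.mem_finset_image, Finset.mem_Icc]

theorem sdiff_jumped_succ (C : Finset (ℤ × ℤ)) (b v : ℤ × ℤ) (k : ℕ) :
    C \ jumped b v (k + 1) = (C \ jumped b v k).erase (ray b v (k + 1)) := by
  rw [jumped, ← Finset.insert_Icc_right_eq_Icc_add_one (by omega), Finset.image_insert,
    Finset.sdiff_insert]
  push_cast
  rfl

/-- Chaps occupy the first `k` points met by the ball at `b` in direction `v`, but not the next. -/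
def Line (b v : ℤ × ℤ) (C : Finset (ℤ × ℤ)) (k : ℕ) : Prop :=
  (∀ i : ℕ, 1 ≤ i → i ≤ k → ray b v i ∈ C) ∧ ray b v (k + 1) ∉ C

theorem Line.unique {b v : ℤ × ℤ} {C : Finset (ℤ × ℤ)} {k l : ℕ} (hk : Line b v C k)
    (hl : Line b v C l) : k = l := by
  rcases lt_trichotomy k l with h | h | h
  · exact absurd (by exact_mod_cast hl.1 (k + 1) (by omega) h) hk.2
  · exact h
  · exact absurd (by exact_mod_cast hk.1 (l + 1) (by omega) h) hl.2

theorem ray_succ (b v : ℤ × ℤ) (i : ℤ) :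
    ray b v (i + 1) = ((ray b v i).1 + v.1, (ray b v i).2 + v.2) := by
  simp only [ray, Prod.mk.injEq]
  constructor <;> ring

theorem slide_spec {b : ℤ × ℤ} {D : ℕ} (hD : D ∈ codes) {C : Finset (ℤ × ℤ)}
    (hC : ∀ q ∈ C, OnBoard 12 10 q) (fuel : ℕ) :
    ∀ (j p c : ℕ), point p = ray b (vec D) (j + 1) →
      (∀ i : ℕ, 1 ≤ i → i ≤ j → ray b (vec D) i ∈ C) → Rep c (C \ jumped b (vec D) j) →
      (∀ {α : Type} (k : ℕ → ℕ → α) (out : α), slide k out D fuel p c = out) ∨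
      ∃ l p' c', j ≤ l ∧ Line b (vec D) C l ∧ point p' = ray b (vec D) (l + 1) ∧
        Rep c' (C \ jumped b (vec D) l) ∧
        ∀ {α : Type} (k : ℕ → ℕ → α) (out : α), slide k out D fuel p c = k p' c' := by
  have hv : vec D ∈ dirs := mem_dirs_iff.2 ⟨D, hD, rfl⟩
  induction fuel with
  | zero => exact fun j p c _ _ _ => Or.inl fun k out => rfl
  | succ fuel ih =>
    intro j p c hp hline hc
    have hmem : occupied c p = true ↔ ray b (vec D) (j + 1) ∈ C := by
      have hj := ray_mem_jumped (b := b) hv (i := j + 1) (k := j)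
      push_cast at hj
      rw [hc.occupied_iff, hp, Finset.mem_sdiff, hj]
      simp
    by_cases ho : occupied c p = true
    · have hpC : point p ∈ C := hp ▸ hmem.1 ho
      have key := ih (j + 1) (step p D) (Nat.xor c (Nat.pow 2 p))
        (by
          rw [point_step (hC _ hpC) hD, hp]
          push_cast
          rw [ray_succ _ _ (j + 1 : ℤ)])
        (fun i h₁ h₂ => by
          rcases Nat.lt_or_ge j i with h | h
          · obtain rfl : i = j + 1 := by omega
            exact_mod_cast hmem.1 ho
          · exact hline i h₁ h)
        (by
          rw [sdiff_jumped_succ, ← hp]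
          exact hc.erase ((hc.occupied_iff p).1 ho))
      have hs : ∀ {α : Type} (k : ℕ → ℕ → α) (out : α), slide k out D (fuel + 1) p c =
          slide k out D fuel (step p D) (Nat.xor c (Nat.pow 2 p)) := fun k out => by
        rw [slide, ho, cond_true]
      rcases key with h | ⟨l, p', c', hl, h₁, h₂, h₃, h₄⟩
      · exact Or.inl fun k out => (hs k out).trans (h k out)
      · exact Or.inr ⟨l, p', c', by omega, h₁, h₂, h₃, fun k out => (hs k out).trans (h₄ k out)⟩
    · refine Or.inr ⟨j, p, c, le_rfl, ⟨hline, fun h => ho (hmem.2 h)⟩, hp, hc, fun k out => ?_⟩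
      rw [Bool.not_eq_true] at ho
      rw [slide, ho, cond_false]

theorem slide_step_spec {b c D : ℕ} {C : Finset (ℤ × ℤ)} (hb : OnBoard 12 10 (point b))
    (hc : Rep c C) (hD : D ∈ codes) (fuel : ℕ) :
    (∀ {α : Type} (k : ℕ → ℕ → α) (out : α), slide k out D fuel (step b D) c = out) ∨
      ∃ l p' c', Line (point b) (vec D) C l ∧ point p' = ray (point b) (vec D) (l + 1) ∧
        Rep c' (C \ jumped (point b) (vec D) l) ∧
        ∀ {α : Type} (k : ℕ → ℕ → α) (out : α), slide k out D fuel (step b D) c = k p' c' := by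
  rcases slide_spec (b := point b) hD hc.onBoard fuel 0 (step b D) c
    (by rw [point_step hb hD]; simp [ray]) (by omega) (by simpa [jumped] using hc) with h | h
  · exact Or.inl h
  · obtain ⟨l, p', c', -, h⟩ := h
    exact Or.inr ⟨l, p', c', h⟩

/-- The hop of `b` in the direction coded by `D` is computed by `hop`. -/
theorem hop_spec {b c D : ℕ} {C : Finset (ℤ × ℤ)} (hb : OnBoard 12 10 (point b))
    (hc : Rep c C) (hD : D ∈ codes) :
    (∀ {α : Type} (k : ℕ → ℕ → α) (out illegal : α), hop k out illegal b c D = out) ∨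
    (¬ (∃ l, 1 ≤ l ∧ Line (point b) (vec D) C l ∧ 1 ≤ (ray (point b) (vec D) (l + 1)).1 ∧
        (ray (point b) (vec D) (l + 1)).1 ≤ 10) ∧
      ∀ {α : Type} (k : ℕ → ℕ → α) (out illegal : α), hop k out illegal b c D = illegal) ∨
    ∃ l p' c', 1 ≤ l ∧ Line (point b) (vec D) C l ∧ legalColumn p' = true ∧
      point p' = ray (point b) (vec D) (l + 1) ∧ Rep c' (C \ jumped (point b) (vec D) l) ∧
      ∀ {α : Type} (k : ℕ → ℕ → α) (out illegal : α), hop k out illegal b c D = k p' c' := by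
  have hr : point (step b D) = ray (point b) (vec D) (1 : ℕ) := by
    rw [point_step hb hD]
    simp [ray]
  by_cases ho : occupied c (step b D) = true
  · rcases slide_step_spec hb hc hD 13 with h | ⟨l, p', c', hl, hp, hr', h⟩
    · exact Or.inl fun k out illegal => by rw [hop, ho, cond_true, h]
    · by_cases hcol : legalColumn p' = true
      · refine Or.inr (Or.inr ⟨l, p', c', ?_, hl, hcol, hp, hr', fun k out illegal => ?_⟩)
        · by_contra! h0
          obtain rfl : l = 0 := by omega
          refine hl.2 ?_
          rw [hc.occupied_iff, hr] at ho
          simpa using ho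
        · rw [hop, ho, cond_true, h, hcol, cond_true]
      · refine Or.inr (Or.inl ⟨?_, fun k out illegal => ?_⟩)
        · rintro ⟨l', -, hl', hcol'⟩
          rw [hl'.unique hl, ← hp, ← legalColumn_iff] at hcol'
          exact hcol hcol'
        · rw [Bool.not_eq_true] at hcol
          rw [hop, ho, cond_true, h, hcol, cond_false]
  · refine Or.inr (Or.inl ⟨?_, fun k out illegal => ?_⟩)
    · rintro ⟨l, h1, hl, -⟩
      exact ho ((hc.occupied_iff _).2 (hr ▸ hl.1 1 le_rfl h1))
    · rw [Bool.not_eq_true] at ho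
      rw [hop, ho, cond_false]

theorem exists_hop_of_hop_eq {α : Type} {k : ℕ → ℕ → α} {none' : α} {b c D : ℕ}
    {C : Finset (ℤ × ℤ)} (hb : OnBoard 12 10 (point b)) (hc : Rep c C) (hD : D ∈ codes)
    (h : hop k none' none' b c D ≠ none') :
    ∃ p' c' C', Hop 10 (point b) C (point p') C' ∧ Rep c' C' ∧ legalColumn p' = true ∧
      hop k none' none' b c D = k p' c' := by
  rcases hop_spec hb hc hD with h' | ⟨-, h'⟩ | ⟨l, p', c', hl, hL, hcol, hp, hr, h'⟩
  · exact absurd (h' _ _ _) h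
  · exact absurd (h' _ _ _) h
  · have hcol' := legalColumn_iff.1 hcol
    exact ⟨p', c', _, ⟨vec D, mem_dirs_iff.2 ⟨D, hD, rfl⟩, l, hl, hL.1, hL.2, hp ▸ hcol'.1,
      hp ▸ hcol'.2, hp, rfl⟩, hr, hcol, h' _ _ _⟩

theorem hop_true_of_hop {k : ℕ → ℕ → Bool} {b c : ℕ}
    {C C' : Finset (ℤ × ℤ)} {b' : ℤ × ℤ} (hb : OnBoard 12 10 (point b)) (hc : Rep c C)
    (hh : Hop 10 (point b) C b' C') (h : ∀ D ∈ codes, hop k false true b c D = true) :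
    ∃ p' c', b' = point p' ∧ Rep c' C' ∧ legalColumn p' = true ∧ k p' c' = true := by
  obtain ⟨v, hv, l, hl, hL₁, hL₂, hcol₁, hcol₂, rfl, rfl⟩ := hh
  obtain ⟨D, hD, rfl⟩ := mem_dirs_iff.1 hv
  specialize h D hD
  rcases hop_spec hb hc hD with h' | ⟨hno, -⟩ | ⟨l', p', c', -, hL', hcol, hp, hr, h'⟩
  · simp [h'] at h
  · exact absurd ⟨l, hl, ⟨hL₁, hL₂⟩, hcol₁, hcol₂⟩ hno
  · obtain rfl := hL'.unique ⟨hL₁, hL₂⟩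
    exact ⟨p', c', hp.symm, hr, hcol, (h' k false true) ▸ h⟩

theorem subset_of_hop {n : ℤ} {b b' : ℤ × ℤ} {C C' : Finset (ℤ × ℤ)} (h : Hop n b C b' C') :
    C' ⊆ C := by
  obtain ⟨v, -, k, -, -, -, -, -, -, rfl⟩ := h
  exact Finset.sdiff_subset

theorem hop_insert {n : ℤ} {b b' q : ℤ × ℤ} {C C' : Finset (ℤ × ℤ)} (h : Hop n b C b' C')
    (hq : q ∉ C) (hb' : q ≠ b') : Hop n b (insert q C) b' (insert q C') := by
  obtain ⟨v, hv, k, hk, hline, hfree, h₁, h₂, rfl, rfl⟩ := h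
  refine ⟨v, hv, k, hk, fun i hi hik => Finset.mem_insert_of_mem (hline i hi hik), ?_, h₁, h₂, rfl,
    ?_⟩
  · rw [Finset.mem_insert, not_or]
    exact ⟨hb'.symm, hfree⟩
  · rw [Finset.insert_sdiff_of_notMem]
    intro hmem
    obtain ⟨i, hi, rfl⟩ := Finset.mem_image.1 hmem
    rw [Finset.mem_Icc] at hi
    exact hq (hline i hi.1 hi.2)

end Hops

section Jumps

theorem exists_jump_of_jumpAny {f : ℕ → ℕ → Bool} {n : ℕ} :
    ∀ {b c : ℕ} {C : Finset (ℤ × ℤ)}, OnBoard 12 10 (point b) → Rep c C →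
      jumpAny f n b c = true → ∃ p c' C', Jump 12 10 (point b) C (point p) C' ∧ Rep c' C' ∧
        legalColumn p = true ∧ f p c' = true := by
  induction n with
  | zero => intro b c C _ _ h; simp [jumpAny] at h
  | succ n ih =>
    intro b c C hb hc h
    rw [jumpAny, List.any_eq_true] at h
    obtain ⟨D, hD, h⟩ := h
    obtain ⟨p, c', C', hh, hr, hcol, he⟩ := exists_hop_of_hop_eq hb hc hD (by rw [h]; simp)
    rw [h, eq_comm, Bool.or_eq_true, Bool.and_eq_true] at he
    rcases he with he | ⟨hrow, he⟩
    · exact ⟨p, c', C', .single hh, hr, hcol, he⟩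
    · obtain ⟨p₂, c₂, C₂, hj, h₂⟩ := ih (onBoard_point_iff.2 ⟨hcol, hrow⟩) hr he
      have hrow' := onRows_iff.1 hrow
      exact ⟨p₂, c₂, C₂, .cons hh hrow'.1 hrow'.2 hj, h₂⟩

theorem forall_jump_of_jumpAll {f : ℕ → ℕ → Bool} {n : ℕ} :
    ∀ {b c : ℕ} {C : Finset (ℤ × ℤ)}, OnBoard 12 10 (point b) → Rep c C →
      jumpAll f n b c = true → ∀ {b' C'}, Jump 12 10 (point b) C b' C' →
        ∃ p c', b' = point p ∧ Rep c' C' ∧ legalColumn p = true ∧ f p c' = true := by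
  induction n with
  | zero => intro b c C _ _ h; simp [jumpAll] at h
  | succ n ih =>
    intro b c C hb hc h b' C' hj
    rw [jumpAll, List.all_eq_true] at h
    cases hj with
    | single hh =>
      obtain ⟨p, c', rfl, hr, hcol, he⟩ := hop_true_of_hop hb hc hh h
      rw [Bool.and_eq_true] at he
      exact ⟨p, c', rfl, hr, hcol, he.1⟩
    | cons hh h₁ h₂ hj =>
      obtain ⟨p, c', rfl, hr, hcol, he⟩ := hop_true_of_hop hb hc hh h
      have hrow := onRows_iff.2 ⟨h₁, h₂⟩
      rw [Bool.and_eq_true, hrow, Bool.not_true, Bool.false_or] at he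
      exact ih (onBoard_point_iff.2 ⟨hcol, hrow⟩) hr he.2 hj

/-- A winning jump of `pl`, hopping to the points in a list. -/
inductive WinPath (pl : Player) : ℤ × ℤ → Finset (ℤ × ℤ) → List (ℤ × ℤ) → Prop
  | last {b C b' C'} : Hop 10 b C b' C' → winner 12 ⟨b', C', pl⟩ = some pl →
      WinPath pl b C [b']
  | cons {b C b' C' R} : Hop 10 b C b' C' → 1 ≤ b'.2 → b'.2 ≤ 12 → WinPath pl b' C' R →
      WinPath pl b C (b' :: R)

theorem WinPath.exists_jump {pl : Player} {b : ℤ × ℤ} {C : Finset (ℤ × ℤ)} {R : List (ℤ × ℤ)}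
    (h : WinPath pl b C R) (t : Player) :
    ∃ b' C', Jump 12 10 b C b' C' ∧ winner 12 ⟨b', C', t⟩ = some pl := by
  induction h with
  | last hh hw => exact ⟨_, _, .single hh, hw⟩
  | cons hh h₁ h₂ _ ih =>
    obtain ⟨b', C', hj, hw⟩ := ih
    exact ⟨b', C', .cons hh h₁ h₂ hj, hw⟩

theorem WinPath.insert {pl : Player} {b q : ℤ × ℤ} {C : Finset (ℤ × ℤ)} {R : List (ℤ × ℤ)}
    (h : WinPath pl b C R) (hq : q ∉ C) (hR : q ∉ R) : WinPath pl b (insert q C) R := by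
  induction h with
  | last hh hw => exact .last (hop_insert hh hq (by simpa using hR)) hw
  | cons hh h₁ h₂ _ ih =>
    rw [List.mem_cons, not_or] at hR
    exact .cons (hop_insert hh hq hR.1) h₁ h₂ (ih (fun h => hq (subset_of_hop hh h)) hR.2)

theorem winPath_of_threat {pl : Player} {n : ℕ} :
    ∀ {b c : ℕ} {C : Finset (ℤ × ℤ)} {R : List ℕ}, OnBoard 12 10 (point b) → Rep c C →
      threat pl n b c = some R → WinPath pl (point b) C (R.map point) := by
  induction n with
  | zero => intro b c C R _ _ h; simp [threat] at h
  | succ n ih =>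
    intro b c C R hb hc h
    rw [threat] at h
    obtain ⟨D, hD, h⟩ := List.exists_of_findSome?_eq_some h
    obtain ⟨p, c', C', hh, hr, hcol, he⟩ := exists_hop_of_hop_eq hb hc hD (by rw [h]; simp)
    rw [h, eq_comm] at he
    by_cases hw : wonBy pl p = true
    · rw [hw, cond_true, Option.some_inj] at he
      subst he
      exact .last hh (wonBy_iff.1 hw)
    · rw [Bool.not_eq_true] at hw
      rw [hw, cond_false] at he
      by_cases hrow : onRows p = true
      · rw [hrow, cond_true, Option.map_eq_some_iff] at he
        obtain ⟨R', hR', rfl⟩ := he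
        have hrow' := onRows_iff.1 hrow
        exact .cons hh hrow'.1 hrow'.2 (ih (onBoard_point_iff.2 ⟨hcol, hrow⟩) hr hR')
      · rw [Bool.not_eq_true] at hrow
        simp [hrow] at he

end Jumps

section Search

theorem vacant_iff {b c q : ℕ} {C : Finset (ℤ × ℤ)} (hc : Rep c C) :
    vacant b c q = true ↔ OnBoard 12 10 (point q) ∧ point q ∉ C ∧ point q ≠ point b := by
  rw [onBoard_point_iff, ← hc.occupied_iff, point_injective.ne_iff, vacant]
  have : Nat.beq q b = false ↔ q ≠ b := by
    rw [← Bool.not_eq_true, Nat.beq_eq]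
  simp only [Bool.and_eq_true, Bool.not_eq_true', this, Bool.not_eq_true]
  tauto

variable {pl : Player} {b c : ℕ} {C : Finset (ℤ × ℤ)}

theorem moveRel_of_vacant (hc : Rep c C) (t : Player) {q : ℕ} (hq : vacant b c q = true) :
    MoveRel 12 10 ⟨point b, C, t⟩ ⟨point b, insert (point q) C, !t⟩ :=
  have h := (vacant_iff hc).1 hq
  ⟨rfl, Or.inl ⟨point q, h.1, h.2.1, h.2.2, rfl, rfl⟩⟩

/-- A move is a jump or the placement of a chap at a vacant point. -/
theorem moveRel_cases (hc : Rep c C) {t : Player} {s : PState}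
    (h : MoveRel 12 10 ⟨point b, C, t⟩ s) :
    (∃ b' C', Jump 12 10 (point b) C b' C' ∧ s = ⟨b', C', !t⟩) ∨
      ∃ q, vacant b c q = true ∧ s = ⟨point b, insert (point q) C, !t⟩ := by
  obtain ⟨ball, chaps, turn⟩ := s
  obtain ⟨ht, ⟨q, hq, h₁, h₂, hb, hc'⟩ | hj⟩ := h
  · dsimp only at *
    obtain ⟨q, rfl⟩ := exists_point_eq hq
    exact Or.inr ⟨q, (vacant_iff hc).2 ⟨hq, h₁, h₂⟩, by rw [ht, hb, hc']⟩
  · dsimp only at *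
    exact Or.inl ⟨ball, chaps, hj, by rw [ht]⟩

theorem WinPath.reach {T : PState → Prop} {b : ℤ × ℤ} {R : List (ℤ × ℤ)} (h : WinPath pl b C R)
    (hw : winner 12 ⟨b, C, pl⟩ = none) : Reach 12 10 pl T 1 ⟨b, C, pl⟩ := by
  obtain ⟨b', C', hj, hw'⟩ := h.exists_jump (!pl)
  exact Or.inr ⟨hw, Or.inl ⟨rfl, ⟨b', C', !pl⟩, ⟨rfl, Or.inr hj⟩, Or.inl hw'⟩⟩

theorem WinPath.exists_move {b : ℤ × ℤ} {R : List (ℤ × ℤ)} (h : WinPath pl b C R) (t : Player) :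
    ∃ s, MoveRel 12 10 ⟨b, C, t⟩ s := by
  obtain ⟨b', C', hj, -⟩ := h.exists_jump (!t)
  exact ⟨⟨b', C', !t⟩, rfl, Or.inr hj⟩

theorem reach_of_defend {T : PState → Prop} {n : ℕ} {attack : ℕ → ℕ → Bool} {points : List ℕ}
    (hb : legalColumn b = true) (hu : undecided b = true) (hc : Rep c C)
    (hattack : ∀ {b c C}, legalColumn b = true → undecided b = true → Rep c C →
      attack b c = true → Reach 12 10 pl T n ⟨point b, C, pl⟩)
    (h : defend pl attack points b c = true) {s : PState}
    (hs : MoveRel 12 10 ⟨point b, C, !pl⟩ s) :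
    Reach 12 10 pl T n s ∨
      ∃ q, vacant b c q = true ∧ q ∉ points ∧ s = ⟨point b, insert (point q) C, pl⟩ := by
  rw [defend, Bool.and_eq_true, List.all_eq_true] at h
  obtain ⟨hjump, hplace⟩ := h
  rcases moveRel_cases hc hs with ⟨b', C', hj, rfl⟩ | ⟨q, hq, rfl⟩
  · rw [Bool.not_not]
    obtain ⟨p, c', rfl, hr, hcol, he⟩ :=
      forall_jump_of_jumpAll (onBoard_of_undecided hb hu) hc hjump hj
    rw [Bool.or_eq_true, Bool.and_eq_true] at he
    rcases he with he | ⟨hu', he⟩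
    · exact Or.inl (Reach.mono (Nat.zero_le n) (Or.inl (wonBy_iff.1 he)))
    · exact Or.inl (hattack hcol hu' hr he)
  · rw [Bool.not_not]
    by_cases hqp : q ∈ points
    · have := hplace q hqp
      rw [hq, Bool.not_true, Bool.false_or] at this
      exact Or.inl (hattack hb hu (hc.place ((vacant_iff hc).1 hq).1) this)
    · exact Or.inr ⟨q, hq, hqp, rfl⟩

/-- A chap away from the `escapes` leaves the opponent of `pl` only losing jumps. -/
theorem winner_of_hop_of_escape {D y : ℕ} {v : ℕ} {b' : ℤ × ℤ} {C' : Finset (ℤ × ℤ)}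
    (hb : OnBoard 12 10 (point b)) (hc : Rep c C) (hD : D ∈ codes)
    (hv : escape pl b c D = some v) (hy : y ≠ v) {k : ℕ} (hk : 1 ≤ k)
    (hline : Line (point b) (vec D) (insert (point y) C) k)
    (hb' : b' = ray (point b) (vec D) (k + 1)) (h₁ : 1 ≤ b'.1) (h₂ : b'.1 ≤ 10) :
    winner 12 ⟨b', C', pl⟩ = some pl ∧ ¬ (1 ≤ b'.2 ∧ b'.2 ≤ 12) := by
  have hd : vec D ∈ dirs := mem_dirs_iff.2 ⟨D, hD, rfl⟩
  rcases slide_step_spec hb hc hD 13 with h | ⟨l, p, c', hl, hp, -, h⟩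
  · rw [escape, h] at hv
    simp at hv
  rw [escape, h] at hv
  have hlk : Line (point b) (vec D) (insert (point y) C) l := by
    refine ⟨fun i h₁ h₂ => Finset.mem_insert_of_mem (hl.1 i h₁ h₂), ?_⟩
    rw [Finset.mem_insert, not_or, ← hp, point_injective.eq_iff]
    refine ⟨?_, hp ▸ hl.2⟩
    rintro rfl
    rcases hcond : (p.beq (step b D) || !legalColumn p || wonBy pl p && !onRows p) with _ | _ <;>
      simp [hcond] at hv
    exact hy hv
  obtain rfl := hlk.unique hline
  rw [← hp] at hb'
  subst hb'
  have hcond : (p.beq (step b D) || !legalColumn p || wonBy pl p && !onRows p) = true := by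
    by_contra hcond
    rw [Bool.not_eq_true] at hcond
    simp [hcond] at hv
  rw [Bool.or_eq_true, Bool.or_eq_true, Bool.and_eq_true, Bool.not_eq_true', Bool.not_eq_true',
    Nat.beq_eq, legalColumn_iff.2 ⟨h₁, h₂⟩] at hcond
  rcases hcond with (hcond | hcond) | ⟨hw, hrow⟩
  · rw [hcond, point_step hb hD] at hp
    have h1 : ray (point b) (vec D) (1 : ℤ) = ray (point b) (vec D) (l + 1) := by
      rw [← hp]
      simp [ray]
    have := ray_injective hd h1
    omega
  · simp at hcond
  · exact ⟨wonBy_iff.1 hw, fun h => by simp [onRows_iff.2 h] at hrow⟩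

theorem mem_escapes {l E : List ℕ} (h : escapes pl b c l = some E) :
    ∀ D ∈ l, ∃ v ∈ E, escape pl b c D = some v := by
  induction l generalizing E with
  | nil => simp
  | cons D l ih =>
    rw [escapes, Option.bind_eq_some_iff] at h
    obtain ⟨v, hv, h⟩ := h
    rw [Option.map_eq_some_iff] at h
    obtain ⟨E, hE, rfl⟩ := h
    intro D' hD'
    rcases List.mem_cons.1 hD' with rfl | hD'
    · exact ⟨v, List.mem_cons_self, hv⟩
    · obtain ⟨w, hw, h⟩ := ih hE D' hD'
      exact ⟨w, List.mem_cons_of_mem v hw, h⟩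

theorem winner_of_jump_of_escapes {E : List ℕ} {y : ℕ} {b' : ℤ × ℤ} {C' : Finset (ℤ × ℤ)}
    (hb : OnBoard 12 10 (point b)) (hc : Rep c C) (hE : escapes pl b c codes = some E)
    (hy : y ∉ E) (hj : Jump 12 10 (point b) (insert (point y) C) b' C') (t : Player) :
    winner 12 ⟨b', C', t⟩ = some pl := by
  have key : ∀ {b₁ C₁}, Hop 10 (point b) (insert (point y) C) b₁ C₁ →
      winner 12 ⟨b₁, C₁, pl⟩ = some pl ∧ ¬ (1 ≤ b₁.2 ∧ b₁.2 ≤ 12) := by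
    rintro b₁ C₁ ⟨d, hd, k, hk, hl₁, hl₂, h₁, h₂, hb₁, -⟩
    obtain ⟨D, hD, rfl⟩ := mem_dirs_iff.1 hd
    obtain ⟨v, hv, h⟩ := mem_escapes hE D hD
    exact winner_of_hop_of_escape hb hc hD h (ne_of_mem_of_not_mem hv hy).symm hk ⟨hl₁, hl₂⟩ hb₁
      (hb₁ ▸ h₁) (hb₁ ▸ h₂)
  cases hj with
  | single hh => exact (key hh).1
  | cons hh h₁ h₂ _ => exact absurd ⟨h₁, h₂⟩ (key hh).2

theorem reach_of_follow {T : PState → Prop} {r y : ℕ} {E : List ℕ}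
    (hb : legalColumn b = true) (hu : undecided b = true) (hc : Rep c C)
    (h : follow pl b c r = some E) (hy : vacant b c y = true) (hyE : y ∉ E) :
    Reach 12 10 pl T 3 ⟨point b, insert (point y) C, pl⟩ := by
  have hb' := onBoard_of_undecided hb hu
  by_cases hr : vacant b c r = true
  swap
  · rw [Bool.not_eq_true] at hr
    simp [follow, hr] at h
  rw [follow, hr, cond_true, Option.bind_eq_some_iff] at h
  obtain ⟨R, hR, h⟩ := h
  by_cases hfree : R.any (vacant b (place c r)) = true
  · simp [hfree] at h
  rw [Bool.not_eq_true] at hfree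
  rw [hfree, cond_false, Option.map_eq_some_iff] at h
  obtain ⟨X, hX, rfl⟩ := h
  simp only [List.mem_append, List.mem_singleton, not_or] at hyE
  obtain ⟨hyX, hyR, hyr⟩ := hyE
  have hr' := (vacant_iff hc).1 hr
  have hy' := (vacant_iff hc).1 hy
  have hc₁ : Rep (place c r) (insert (point r) C) := hc.place hr'.1
  have hcy := hc.place hy'.1
  have hyr' : point y ≠ point r := point_injective.ne hyr
  have hcyr : Rep (place (place c y) r) (insert (point r) (insert (point y) C)) :=
    hcy.place hr'.1
  have hyC₁ : point y ∉ insert (point r) C := by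
    simp [hyr', hy'.2.1]
  have hpath := (winPath_of_threat hb' hc₁ hR).insert hyC₁
    (by rwa [List.mem_map_of_injective point_injective])
  rw [Finset.insert_comm] at hpath
  have hmove : vacant b (place c y) r = true := by
    rw [vacant_iff hcy]
    simp [hr'.1, hr'.2.1, hr'.2.2, hyr'.symm]
  refine Or.inr ⟨undecided_iff.1 hu, Or.inl ⟨rfl, _, moveRel_of_vacant hcy pl hmove, ?_⟩⟩
  refine Or.inr ⟨undecided_iff.1 hu, Or.inr ⟨rfl, hpath.exists_move _, fun s hs => ?_⟩⟩
  rcases moveRel_cases hcyr hs with ⟨b', C', hj, rfl⟩ | ⟨q, hq, rfl⟩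
  · rw [Finset.insert_comm] at hj
    exact Or.inl (Or.inl (winner_of_jump_of_escapes hb' hc₁ hX hyX hj _))
  · rw [Bool.not_not]
    have hq' := (vacant_iff hcyr).1 hq
    refine (hpath.insert hq'.2.1 ?_).reach (undecided_iff.1 hu)
    rw [List.mem_map_of_injective point_injective]
    intro hqR
    rw [List.any_eq_false] at hfree
    refine hfree q hqR ((vacant_iff hc₁).2 ⟨hq'.1, fun h => hq'.2.1 ?_, hq'.2.2⟩)
    rw [Finset.insert_comm]
    exact Finset.mem_insert_of_mem h

/-- The positions in a list, with the opponent of `pl` to move. -/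
def Listed (L : List (ℕ × ℕ)) (pl : Player) (s : PState) : Prop :=
  ∃ e ∈ L, s.ball = point e.1 ∧ Rep e.2 s.chaps ∧ s.turn = !pl

theorem listed_iff {L : List (ℕ × ℕ)} : listed L b c = true ↔ (b, c) ∈ L := by
  simp only [listed, List.any_eq_true, Bool.and_eq_true, Nat.beq_eq]
  constructor
  · rintro ⟨⟨_, _⟩, h, rfl, rfl⟩
    exact h
  · exact fun h => ⟨_, h, rfl, rfl⟩

theorem reach_of_solve {L : List (ℕ × ℕ)} {plan : List (List (ℕ × Option ℕ))} :
    ∀ {b c : ℕ} {C : Finset (ℤ × ℤ)}, legalColumn b = true → undecided b = true → Rep c C →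
      solve L pl plan b c = true →
        Reach 12 10 pl (Listed L pl) (2 * plan.length + 3) ⟨point b, C, pl⟩ := by
  induction plan with
  | nil =>
    intro b c C hb hu hc h
    obtain ⟨p, c', C', hj, hr, hcol, hw⟩ :=
      exists_jump_of_jumpAny (onBoard_of_undecided hb hu) hc h
    refine Reach.mono (j := 1) (by omega) (Or.inr ⟨undecided_iff.1 hu, Or.inl ⟨rfl,
      ⟨point p, C', !pl⟩, ⟨rfl, Or.inr hj⟩, Or.inl (wonBy_iff.1 hw)⟩⟩)
  | cons hints plan ih =>
    intro b c C hb hu hc h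
    rw [solve, Bool.or_eq_true, List.any_eq_true] at h
    rcases h with h | ⟨⟨q, r⟩, -, h⟩
    · obtain ⟨p, c', C', hj, hr, hcol, hw⟩ :=
        exists_jump_of_jumpAny (onBoard_of_undecided hb hu) hc h
      refine Reach.mono (j := 1) (by omega) (Or.inr ⟨undecided_iff.1 hu, Or.inl ⟨rfl,
        ⟨point p, C', !pl⟩, ⟨rfl, Or.inr hj⟩, ?_⟩⟩)
      rw [Bool.or_eq_true, Bool.and_eq_true, listed_iff] at hw
      exact hw.imp wonBy_iff.1 fun h => ⟨_, h.2, rfl, hr, rfl⟩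
    · rw [Bool.and_eq_true, Bool.or_eq_true, listed_iff] at h
      obtain ⟨hq, h⟩ := h
      have hc' : Rep (place c q) (insert (point q) C) := hc.place ((vacant_iff hc).1 hq).1
      suffices Reach 12 10 pl (Listed L pl) (2 * plan.length + 3 + 1)
          ⟨point b, insert (point q) C, !pl⟩ from
        Or.inr ⟨undecided_iff.1 hu, Or.inl ⟨rfl, _, moveRel_of_vacant hc pl hq, this⟩⟩
      rcases h with h | h
      · exact Reach.mono (Nat.zero_le _) (Or.inr ⟨_, h, rfl, hc', rfl⟩)
      cases hp : pressure pl b (place c q) r with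
      | none => simp [hp] at h
      | some points =>
        simp only [hp] at h
        have hdef := fun s hs => reach_of_defend (s := s) hb hu hc' ih h hs
        rw [pressure, Option.or_eq_some_iff] at hp
        refine Or.inr ⟨undecided_iff.1 hu, Or.inr ⟨rfl, ?_⟩⟩
        rcases hp with hp | ⟨-, hp⟩
        · have hpath := winPath_of_threat (onBoard_of_undecided hb hu) hc' hp
          refine ⟨hpath.exists_move _, fun s hs => ?_⟩
          rcases hdef s hs with h | ⟨y, hy, hyp, rfl⟩
          · exact h
          · refine Reach.mono (j := 1) (by omega) ?_
            refine (hpath.insert ((vacant_iff hc').1 hy).2.1 ?_).reach (undecided_iff.1 hu)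
            rwa [List.mem_map_of_injective point_injective]
        · rw [Option.bind_eq_some_iff] at hp
          obtain ⟨r, -, hp⟩ := hp
          refine ⟨⟨_, moveRel_of_vacant hc' _ (q := r) ?_⟩, fun s hs => ?_⟩
          · by_contra hr
            rw [Bool.not_eq_true] at hr
            simp [follow, hr] at hp
          · rcases hdef s hs with h | ⟨y, hy, hyp, rfl⟩
            · exact h
            · exact Reach.mono (j := 3) (by omega) (reach_of_follow hb hu hc' hp hy hyp)

end Search

section Checks

theorem bettyPlan_check : defend false (solve [] false bettyPlan)
    (allPoints.filter fun q => !Nat.beq q 50) 33 (mask chapCodes) = true := by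
  decide +kernel

theorem exists_plan_of_mem_trap : ∀ e ∈ trap, ∃ plan,
    defend true (solve trap true plan) allPoints e.1 e.2 = true := by
  have hshort : ((trap.take 8).all fun e =>
      defend true (solve trap true shortPlan) allPoints e.1 e.2) = true := by
    decide +kernel
  have hlong : ((trap.drop 8).all fun e =>
      defend true (solve trap true longPlan) allPoints e.1 e.2) = true := by
    decide +kernel
  rw [List.all_eq_true] at hshort hlong
  intro e he
  rw [← List.take_append_drop 8 trap, List.mem_append] at he
  exact he.elim (fun he => ⟨shortPlan, hshort e he⟩) fun he => ⟨longPlan, hlong e he⟩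

end Checks

section Main

theorem mem_allPoints {q : ℕ} (hq : OnBoard 12 10 (point q)) : q ∈ allPoints := by
  have h := onBoard_point_iff.1 hq
  have hlt : q < 208 := by
    have := h.2
    simp only [onRows, Bool.and_eq_true, Nat.ble_eq] at this
    omega
  simp [allPoints, h, hlt]

theorem rep_P0chaps : Rep (mask chapCodes) P0chaps := by
  have h : P0chaps = (chapCodes.map point).toFinset := by decide +kernel
  rw [h]
  refine Rep.mask fun q hq => ?_
  rw [onBoard_point_iff]
  revert q
  decide

theorem listed_P0_b3 : Listed trap true P0_b3 := by
  refine ⟨(33, place (mask chapCodes) 50), List.mem_cons_self, rfl, ?_, rfl⟩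
  exact rep_P0chaps.place (q := 50) (by simp [OnBoard, point])

theorem not_winsFrom_P0_b3 : ¬ WinsFrom 12 10 false P0_b3 := by
  refine not_winsFrom_of_trap (p := true) (T := Listed trap true) ?_ listed_P0_b3
  rintro ⟨ball, C, turn⟩ ⟨⟨b, c⟩, he, rfl, hc, ht⟩
  dsimp only at hc ht ⊢
  subst ht
  have hball : ∀ e ∈ trap, legalColumn e.1 = true ∧ undecided e.1 = true := by decide +kernel
  obtain ⟨hb, hu⟩ := hball _ he
  obtain ⟨plan, hplan⟩ := exists_plan_of_mem_trap _ he
  refine ⟨undecided_iff.1 hu, rfl, 2 * plan.length + 3, fun t ht => ?_⟩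
  rcases reach_of_defend hb hu hc reach_of_solve hplan ht with h | ⟨q, hq, hqp, -⟩
  · exact h
  · exact absurd (mem_allPoints ((vacant_iff hc).1 hq).1) hqp

theorem winsFrom_of_moveRel_P0 {t : PState} (ht : MoveRel 12 10 P0 t) (hne : t ≠ P0_b3) :
    WinsFrom 12 10 false t := by
  have hlisted : Listed [] false = fun _ => False := by
    funext s
    simp [Listed]
  have hP0 : P0 = ⟨point 33, P0chaps, !false⟩ := rfl
  rw [hP0] at ht
  rcases reach_of_defend (pl := false) (by decide) (by decide) rep_P0chaps reach_of_solve
    bettyPlan_check ht with h | ⟨q, hq, hqp, rfl⟩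
  · rw [hlisted] at h
    exact winsFrom_of_reach h
  · have hq50 : q = 50 := by
      by_contra h
      refine hqp (List.mem_filter.2 ⟨mem_allPoints ((vacant_iff rep_P0chaps).1 hq).1, ?_⟩)
      rwa [Bool.not_eq_true', ← Bool.not_eq_true, Nat.beq_eq]
    subst hq50
    exact absurd rfl hne

end Main

end Phutball

/-- From `P0`, placing a chap at b3 is Alfred's unique non-losing move:
it is a legal move; after it, Betty has no winning strategy from the resulting
position; and every other legal move of Alfred from `P0` leads to a position
from which Betty has a winning strategy. -/
theorem P0_unique_nonlosing :
    MoveRel 12 10 P0 P0_b3 ∧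
    ¬ WinsFrom 12 10 false P0_b3 ∧
    ∀ t, MoveRel 12 10 P0 t → t ≠ P0_b3 → WinsFrom 12 10 false t := by
  refine ⟨⟨rfl, Or.inl ⟨(2, 3), ?_, ?_, ?_, rfl, rfl⟩⟩, Phutball.not_winsFrom_P0_b3,
    fun t ht hne => Phutball.winsFrom_of_moveRel_P0 ht hne⟩
  · simp [OnBoard]
  · decide
  · decide
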